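/- arXiv:1105.5752 — 13 statements merged into one kernel-verified Lean document; each statement's English description precedes it below -/
import Mathlib

section
/- Let X be a nonempty set and 𝔏, 𝔎 : X → X bijections, and define r : X × X → X × X by r(a,b) = (𝔎(a), 𝔏(b)). Then (1) r is a Yang-Baxter map if and only if 𝔏 ∘ 𝔎 = 𝔎 ∘ 𝔏; and (2) r is a Yang-Baxter map satisfying the unitary condition if and only if 𝔎 = 𝔏⁻¹. -/
/-- `R₁₂` for a non-dynamical map. -/
def Y12 {X : Type*} (R : X × X → X × X) : X × X × X → X × X × X :=
  fun p => ((R (p.1, p.2.1)).1, (R (p.1, p.2.1)).2, p.2.2)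

/-- `R₁₃` for a non-dynamical map. -/
def Y13 {X : Type*} (R : X × X → X × X) : X × X × X → X × X × X :=
  fun p => ((R (p.1, p.2.2)).1, p.2.1, (R (p.1, p.2.2)).2)

/-- `R₂₃` for a non-dynamical map. -/
def Y23 {X : Type*} (R : X × X → X × X) : X × X × X → X × X × X :=
  fun p => (p.1, R (p.2.1, p.2.2))

/-- `R` is a Yang–Baxter map: `R₂₃ ∘ R₁₃ ∘ R₁₂ = R₁₂ ∘ R₁₃ ∘ R₂₃`. -/
def IsYB {X : Type*} (R : X × X → X × X) : Prop :=
  Y23 R ∘ Y13 R ∘ Y12 R = Y12 R ∘ Y13 R ∘ Y23 R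

/-- The unitary condition for a Yang–Baxter map: `P ∘ R ∘ P ∘ R = id`. -/
def YBUnitary {X : Type*} (R : X × X → X × X) : Prop :=
  Prod.swap ∘ R ∘ Prod.swap ∘ R = id

theorem isYB_prodMap_iff {X : Type*} (f g : X → X) :
    IsYB (fun p : X × X => (f p.1, g p.2)) ↔ g ∘ f = f ∘ g := by
  constructor
  · intro h
    funext b
    exact (congrArg (fun p => p.2.1) (congrFun h (b, b, b))).symm
  · intro h
    funext ⟨a, b, c⟩
    exact congrArg (fun y => (f (f a), y, g (g c))) (congrFun h b).symm

theorem ybUnitary_prodMap_iff {X : Type*} (f g : X → X) :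
    YBUnitary (fun p : X × X => (f p.1, g p.2)) ↔ g ∘ f = id ∧ f ∘ g = id := by
  constructor
  · intro h
    exact ⟨funext fun a => congrArg Prod.fst (congrFun h (a, a)),
      funext fun a => congrArg Prod.snd (congrFun h (a, a))⟩
  · rintro ⟨hgf, hfg⟩
    funext ⟨a, b⟩
    exact Prod.ext (congrFun hgf a) (congrFun hfg b)

theorem stmt2 {X : Type*} [Nonempty X] (𝔏 𝔎 : X → X)
    (hL : Function.Bijective 𝔏) (hK : Function.Bijective 𝔎) :
    (IsYB (fun p : X × X => (𝔎 p.1, 𝔏 p.2)) ↔ 𝔏 ∘ 𝔎 = 𝔎 ∘ 𝔏) ∧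
    ((IsYB (fun p : X × X => (𝔎 p.1, 𝔏 p.2)) ∧
        YBUnitary (fun p : X × X => (𝔎 p.1, 𝔏 p.2))) ↔
      (𝔏 ∘ 𝔎 = id ∧ 𝔎 ∘ 𝔏 = id)) := by
  rw [isYB_prodMap_iff, ybUnitary_prodMap_iff]
  exact ⟨Iff.rfl, fun h => h.2, fun h => ⟨h.1.trans h.2.symm, h⟩⟩
end

section
/- Let X and H be nonempty sets, φ : H × X → H a map, and for each (λ,a) ∈ H × X let L^λ_a : X → X be a bijection. Define R^λ_b(a) := (L^λ_{L^λ_a(b)})⁻¹(a). Suppose that for all (λ,a,b) ∈ H × X × X: L^λ_a ∘ L^{φ(λ,a)}_b = L^λ_{L^λ_a(b)} ∘ L^{φ(λ, L^λ_a(b))}_{R^λ_b(a)}. Then the family of maps R(λ) : X × X → X × X defined by R(λ)(a,b) := (R^λ_b(a), L^λ_a(b)) is a right nondegenerate dynamical Yang-Baxter map associated with X, H, φ satisfying the unitary condition. -/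
/-- `R₁₂` with a (possibly dynamical) parameter depending on the point. -/
def R12 {X H : Type*} (R : H → X × X → X × X) (prm : X × X × X → H) :
    X × X × X → X × X × X :=
  fun p => ((R (prm p) (p.1, p.2.1)).1, (R (prm p) (p.1, p.2.1)).2, p.2.2)

/-- `R₁₃` with a (possibly dynamical) parameter depending on the point. -/
def R13 {X H : Type*} (R : H → X × X → X × X) (prm : X × X × X → H) :
    X × X × X → X × X × X :=
  fun p => ((R (prm p) (p.1, p.2.2)).1, p.2.1, (R (prm p) (p.1, p.2.2)).2)

/-- `R₂₃` with a (possibly dynamical) parameter depending on the point. -/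
def R23 {X H : Type*} (R : H → X × X → X × X) (prm : X × X × X → H) :
    X × X × X → X × X × X :=
  fun p => (p.1, R (prm p) (p.2.1, p.2.2))

/-- The family `R(λ)` is a dynamical Yang–Baxter map associated with `X`, `H`, `φ`. -/
def IsDYB {X H : Type*} (φ : H × X → H) (R : H → X × X → X × X) : Prop :=
  ∀ l : H,
    (R23 R (fun _ => l)) ∘ (R13 R (fun p => φ (l, p.2.1))) ∘ (R12 R (fun _ => l)) =
    (R12 R (fun p => φ (l, p.2.2))) ∘ (R13 R (fun _ => l)) ∘ (R23 R (fun p => φ (l, p.1)))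

/-- The map `L^λ_a`, i.e. `b ↦` second component of `R(λ)(a,b)`. -/
def mfL {X H : Type*} (R : H → X × X → X × X) (l : H) (a : X) : X → X :=
  fun b => (R l (a, b)).2

/-- The map `R^λ_b`, i.e. `a ↦` first component of `R(λ)(a,b)`. -/
def mfR {X H : Type*} (R : H → X × X → X × X) (l : H) (b : X) : X → X :=
  fun a => (R l (a, b)).1


/-- The unitary condition: `P ∘ R(λ) ∘ P ∘ R(λ) = id` where `P` is the flip. -/
def DYBUnitary {X H : Type*} (R : H → X × X → X × X) : Prop :=
  ∀ l : H, Prod.swap ∘ R l ∘ Prod.swap ∘ R l = id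

/-- Right nondegeneracy: every map `L^λ_a` is bijective. -/
def RightNondeg {X H : Type*} (R : H → X × X → X × X) : Prop :=
  ∀ (l : H) (a : X), Function.Bijective (mfL R l a)

theorem stmt4 {X H : Type*} [Nonempty X] [Nonempty H]
    (φ : H × X → H) (L : H → X → X ≃ X)
    (h7 : ∀ (l : H) (a b : X),
      ⇑(L l a) ∘ ⇑(L (φ (l, a)) b) =
        ⇑(L l ((L l a) b)) ∘ ⇑(L (φ (l, (L l a) b)) ((L l ((L l a) b)).symm a))) :
    IsDYB φ (fun l p => ((L l ((L l p.1) p.2)).symm p.1, (L l p.1) p.2)) ∧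
    RightNondeg (fun l p => ((L l ((L l p.1) p.2)).symm p.1, (L l p.1) p.2)) ∧
    DYBUnitary (fun l p => ((L l ((L l p.1) p.2)).symm p.1, (L l p.1) p.2)) := by
  have exchange : ∀ (l : H) (a b c : X), L l a (L (φ (l, a)) b c) =
      L l (L l a b) (L (φ (l, L l a b)) ((L l (L l a b)).symm a) c) :=
    fun l a b c => congrFun (h7 l a b) c
  have exchange_symm : ∀ (l : H) (v w x : X),
      (L (φ (l, v)) ((L l v).symm w)).symm ((L l v).symm x) =
        (L (φ (l, w)) ((L l w).symm v)).symm ((L l w).symm x) := by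
    intro l v w x
    have h := exchange l v ((L l v).symm w)
      ((L (φ (l, v)) ((L l v).symm w)).symm ((L l v).symm x))
    simp only [Equiv.apply_symm_apply] at h
    rw [Equiv.eq_symm_apply, Equiv.eq_symm_apply]
    exact h.symm
  refine ⟨fun l => ?_, fun l a => (L l a).bijective, fun l => ?_⟩
  · funext ⟨a, b, c⟩
    simp only [R12, R13, R23, Function.comp_apply]
    have third := exchange l a b c
    have second : L (φ (l, L l a (L (φ (l, a)) b c)))
        ((L l (L l a (L (φ (l, a)) b c))).symm a)
        ((L (φ (l, a)) (L (φ (l, a)) b c)).symm b) =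
        (L l (L l a (L (φ (l, a)) b c))).symm (L l a b) := by
      rw [Equiv.eq_symm_apply, ← exchange, Equiv.apply_symm_apply]
    have inner : L (φ (l, L l a b)) ((L l (L l a b)).symm a) c =
        (L l (L l a b)).symm (L l a (L (φ (l, a)) b c)) := by
      rw [Equiv.eq_symm_apply, third]
    rw [second, inner, Equiv.apply_symm_apply, exchange_symm]
  · funext ⟨a, b⟩
    simp
end

section
/- Let X be a nonempty set equipped with a commutative binary operation + (associativity not assumed), H a nonempty set, and φ : H × X → H a map. Suppose that for each (λ,a) ∈ H × X, L^λ_a : X → X is a bijection and that for all (λ,a,b) ∈ H × X × X: L^λ_a ∘ L^{φ(λ,a)}_b = L^λ_{L^λ_a(b)+a}. Then the family of maps R(λ) : X × X → X × X defined by R(λ)(a,b) := ((L^λ_{L^λ_a(b)})⁻¹(a), L^λ_a(b)) is a right nondegenerate dynamical Yang-Baxter map associated with X, H, φ satisfying the unitary condition. -/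
/-- Commutativity of `add` lets one exchange the pair `(a, b)` with its image under the braiding. -/
theorem comp_exchange {X H : Type*} {add : X → X → X} (hcomm : ∀ x y : X, add x y = add y x)
    {φ : H × X → H} {L : H → X → X ≃ X}
    (h12 : ∀ (l : H) (a b : X),
      ⇑(L l a) ∘ ⇑(L (φ (l, a)) b) = ⇑(L l (add ((L l a) b) a)))
    {l : H} {a b a' b' : X} (hb : L l a b = b') (ha : L l b' a' = a) (c : X) :
    L l b' (L (φ (l, b')) a' c) = L l a (L (φ (l, a)) b c) := by
  have h₁ := congrFun (h12 l b' a') c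
  have h₂ := congrFun (h12 l a b) c
  rw [ha, hcomm] at h₁
  rw [hb] at h₂
  exact h₁.trans h₂.symm

theorem stmt5 {X H : Type*} [Nonempty X] [Nonempty H]
    (add : X → X → X) (hcomm : ∀ x y : X, add x y = add y x)
    (φ : H × X → H) (L : H → X → X ≃ X)
    (h12 : ∀ (l : H) (a b : X),
      ⇑(L l a) ∘ ⇑(L (φ (l, a)) b) = ⇑(L l (add ((L l a) b) a))) :
    IsDYB φ (fun l p => ((L l ((L l p.1) p.2)).symm p.1, (L l p.1) p.2)) ∧
    RightNondeg (fun l p => ((L l ((L l p.1) p.2)).symm p.1, (L l p.1) p.2)) ∧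
    DYBUnitary (fun l p => ((L l ((L l p.1) p.2)).symm p.1, (L l p.1) p.2)) := by
  have key := @comp_exchange X H add hcomm φ L h12
  refine ⟨fun l => funext ?_, fun l a => (L l a).bijective, fun l => funext ?_⟩
  · rintro ⟨a, b, c⟩
    simp only [R12, R13, R23, Function.comp_apply]
    generalize hb' : L l a b = b'
    obtain ⟨a', ha'⟩ : ∃ x, (L l b').symm a = x := ⟨_, rfl⟩
    have ha := (Equiv.symm_apply_eq _).1 ha'
    have hc := key hb' ha.symm c
    rw [ha', hc]
    generalize hc' : L (φ (l, b')) a' c = c₁ at *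
    generalize hd : L (φ (l, a)) b c = d₁ at *
    generalize he : L l a d₁ = e at *
    have hmid : L (φ (l, e)) ((L l e).symm a) ((L (φ (l, a)) d₁).symm b) = (L l e).symm b' := by
      rw [Equiv.eq_symm_apply, key he (Equiv.apply_symm_apply _ _), Equiv.apply_symm_apply, hb']
    have hfst : (L (φ (l, b')) c₁).symm a' = (L (φ (l, e)) ((L l e).symm b')).symm
        ((L l e).symm a) := by
      rw [Equiv.eq_symm_apply, Equiv.eq_symm_apply, key hc (Equiv.apply_symm_apply _ _),
        Equiv.apply_symm_apply, ha]
    rw [hmid, hfst]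
  · rintro ⟨a, b⟩
    simp
end

section
/- Let (A,+) be an abelian group with a multiplication · : A × A → A satisfying the right distributive law (a+b)·c = a·c + b·c for all a,b,c ∈ A. Then (A,+,·) is a brace if and only if A is a group with respect to the operation a * b := a·b + a + b. -/
/-- `(A,+,·)` is a brace. -/
def IsBrace {A : Type*} [AddCommGroup A] (mul : A → A → A) : Prop :=
  (∀ a b c : A, mul (a + b) c = mul a c + mul b c) ∧
  (∀ a b c : A, mul a (mul b c + b + c) = mul (mul a b) c + mul a b + mul a c) ∧
  (∀ b : A, Function.Bijective (fun a => mul a b + a))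

/-- Under right distributivity, the second brace axiom is associativity of `a·b + a + b`. -/
theorem brace_axiom_iff_assoc {A : Type*} [AddCommGroup A] (mul : A → A → A)
    (hdist : ∀ a b c : A, mul (a + b) c = mul a c + mul b c) (a b c : A) :
    mul a (mul b c + b + c) = mul (mul a b) c + mul a b + mul a c ↔
      mul (mul a b + a + b) c + (mul a b + a + b) + c =
        mul a (mul b c + b + c) + a + (mul b c + b + c) := by
  rw [hdist, hdist]
  constructor
  · intro h
    rw [h]
    abel
  · intro h
    apply add_right_cancel (b := a + (mul b c + b + c))
    rw [← add_assoc, ← h]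
    abel

theorem stmt6 {A : Type*} [AddCommGroup A] (mul : A → A → A)
    (hdist : ∀ a b c : A, mul (a + b) c = mul a c + mul b c) :
    IsBrace mul ↔
      ((∀ a b c : A,
          mul (mul a b + a + b) c + (mul a b + a + b) + c =
            mul a (mul b c + b + c) + a + (mul b c + b + c)) ∧
        ∃ e : A, (∀ a : A, mul a e + a + e = a ∧ mul e a + e + a = a) ∧
          ∀ a : A, ∃ b : A, mul a b + a + b = e ∧ mul b a + b + a = e) := by
  constructor
  · rintro ⟨-, h2, h3⟩
    have assoc := fun a b c => (brace_axiom_iff_assoc mul hdist a b c).1 (h2 a b c)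
    have zero_mul' : ∀ c, mul 0 c = 0 := fun c => by simpa using hdist 0 0 c
    have mul_zero' : ∀ a, mul a 0 = 0 := fun a => by
      have h := h2 a 0 0
      simp only [zero_mul', add_zero] at h
      apply (h3 0).injective
      simpa [zero_mul'] using h
    have left_inv : ∀ a, ∃ b, mul b a + b + a = 0 := fun a => by
      obtain ⟨b, hb⟩ := (h3 a).surjective (-a)
      exact ⟨b, by simp only at hb; rw [hb, neg_add_cancel]⟩
    refine ⟨assoc, 0, fun a => ⟨by simp [mul_zero'], by simp [zero_mul']⟩, fun a => ?_⟩
    obtain ⟨b, hb⟩ := left_inv a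
    obtain ⟨c, hc⟩ := left_inv b
    have hac : a = c := by
      have h := assoc c b a
      rw [hb, hc] at h
      simpa [zero_mul', mul_zero'] using h
    exact ⟨b, hac ▸ hc, hb⟩
  · rintro ⟨assoc, e, he, inv⟩
    refine ⟨hdist, fun a b c => (brace_axiom_iff_assoc mul hdist a b c).2 (assoc a b c),
      fun b => ?_⟩
    obtain ⟨b', hr, hl⟩ := inv b
    constructor
    · intro x y hxy
      simp only at hxy
      have hx := assoc x b b'
      have hy := assoc y b b'
      rw [hr, (he _).1] at hx hy
      rw [← hx, ← hy, hxy]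
    · intro y
      have h := assoc (y + b) b' b
      rw [hl, (he _).1] at h
      exact ⟨_, add_right_cancel h⟩
end

section
/- Let (A,+,·) be a brace and for b ∈ A let γ(b) : A → A be the bijection a ↦ a·b + a. Then the map R : A × A → A × A defined by R(a,b) := (γ(γ(a)(b))⁻¹(a), γ(a)(b)) is a nondegenerate Yang-Baxter map satisfying the unitary condition; that is, R satisfies R₂₃ ∘ R₁₃ ∘ R₁₂ = R₁₂ ∘ R₁₃ ∘ R₂₃ on A × A × A, both coordinate maps b ↦ γ(a)(b) and a ↦ γ(γ(a)(b))⁻¹(a) (for each fixed a, respectively fixed b) are bijective, and P ∘ R ∘ P ∘ R = id_{A×A} where P(a,b) = (b,a). -/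
section CircleGroup

variable {A : Type*}

/-- The circle operation `a ∘ b = γ(b)(a) + b` of a brace, as a group structure. -/
abbrev circleGroup [AddCommGroup A] (gamma : A → A ≃ A)
    (hadd : ∀ a b c : A, gamma c (a + b) = gamma c a + gamma c b)
    (hcomp : ∀ a b c : A, gamma (gamma c b + c) a = gamma c (gamma b a)) : Group A :=
  letI : Mul A := ⟨fun a b => gamma b a + b⟩
  letI : One A := ⟨0⟩
  letI : Inv A := ⟨fun b => (gamma b).symm (-b)⟩
  Group.ofLeftAxioms
    (fun a b c => by
      change gamma c (gamma b a + b) + c = gamma (gamma c b + c) a + (gamma c b + c)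
      rw [hadd, hcomp, add_assoc])
    (fun a => by
      change gamma a 0 + a = a
      have h := hadd 0 0 a
      simp_all)
    (fun a => by
      change gamma a ((gamma a).symm (-a)) + a = 0
      simp)

variable [Group A] {gamma : A → A ≃ A}

theorem gamma_one_apply (hcomp : ∀ a b c : A, gamma (b * c) a = gamma c (gamma b a)) (a : A) :
    gamma 1 a = a := by
  apply (gamma 1).injective
  rw [← hcomp, one_mul]

variable [AddCommGroup A]

theorem gamma_symm_mul (hmul : ∀ a b : A, a * b = gamma b a + b) (a b : A) :
    (gamma (gamma a b)).symm a * gamma a b = b * a := by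
  rw [hmul, hmul, Equiv.apply_symm_apply, add_comm]

theorem gamma_symm_eq_inv (hmul : ∀ a b : A, a * b = gamma b a + b)
    (hcomp : ∀ a b c : A, gamma (b * c) a = gamma c (gamma b a)) (a b : A) :
    (gamma (gamma a b)).symm a = ((gamma b).symm a⁻¹)⁻¹ := by
  have h := gamma_symm_mul hmul a b
  set v := (gamma (gamma a b)).symm a
  rw [← inv_eq_iff_eq_inv, Equiv.eq_symm_apply]
  have h₁ : v⁻¹ * b = gamma a b * a⁻¹ := by
    rw [inv_mul_eq_iff_eq_mul, ← mul_assoc, h, mul_inv_cancel_right]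
  rw [hmul, hmul, ← hcomp, mul_inv_cancel, gamma_one_apply hcomp, add_comm] at h₁
  exact add_left_cancel h₁

theorem gamma_symm_bijective (hmul : ∀ a b : A, a * b = gamma b a + b)
    (hcomp : ∀ a b c : A, gamma (b * c) a = gamma c (gamma b a)) (b : A) :
    Function.Bijective fun a => (gamma (gamma a b)).symm a := by
  simp only [gamma_symm_eq_inv hmul hcomp]
  exact (((Equiv.inv A).trans (gamma b).symm).trans (Equiv.inv A)).bijective

theorem isYB_gamma (hmul : ∀ a b : A, a * b = gamma b a + b)
    (hcomp : ∀ a b c : A, gamma (b * c) a = gamma c (gamma b a)) :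
    IsYB (fun p : A × A => ((gamma (gamma p.1 p.2)).symm p.1, gamma p.1 p.2)) := by
  have prod_eq := gamma_symm_mul hmul
  have fst_eq := gamma_symm_eq_inv hmul hcomp
  funext ⟨a, b, c⟩
  simp only [Y12, Y13, Y23, Function.comp_apply]
  generalize hv : (gamma (gamma a b)).symm a = v
  generalize hw : (gamma (gamma b c)).symm b = w
  have hvu : v * gamma a b = b * a := hv ▸ prod_eq a b
  have hwt : w * gamma b c = c * b := hw ▸ prod_eq b c
  have third : gamma (gamma a b) (gamma v c) = gamma a (gamma b c) := by
    rw [← hcomp, ← hcomp, hvu]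
  generalize hx : (gamma (gamma v c)).symm v = x
  generalize hy : (gamma (gamma (gamma a b) (gamma v c))).symm (gamma a b) = y
  generalize hs : (gamma (gamma a (gamma b c))).symm a = s
  generalize hx' : (gamma (gamma s w)).symm s = x'
  have hxv : x * gamma v c = c * v := hx ▸ prod_eq v c
  have hyu : y * gamma (gamma a b) (gamma v c) = gamma v c * gamma a b :=
    hy ▸ prod_eq (gamma a b) (gamma v c)
  have hst : s * gamma a (gamma b c) = gamma b c * a := hs ▸ prod_eq a (gamma b c)
  have hxs : x' * gamma s w = w * s := hx' ▸ prod_eq s w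
  have first : x = x' := by
    rw [← hx, ← hx', fst_eq, fst_eq, ← hv, ← hs, fst_eq, fst_eq, inv_inv, inv_inv, inv_inj,
      Equiv.symm_apply_eq, Equiv.symm_apply_eq, ← hcomp]
    have h : ∀ z, gamma (gamma b c) (gamma w z) = gamma (c * b) z := fun z => by
      rw [← hcomp, hwt]
    rw [← h, ← Equiv.symm_apply_eq, Equiv.apply_symm_apply]
  have second : y = gamma s w := by
    apply mul_left_cancel (a := x)
    apply mul_right_cancel (b := gamma a (gamma b c))
    conv_rhs => rw [first, hxs, mul_assoc, hst, ← mul_assoc, hwt]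
    rw [mul_assoc, ← third, hyu, ← mul_assoc, hxv, mul_assoc, hvu, mul_assoc]
  rw [first, second, third]

end CircleGroup

theorem stmt8 {A : Type*} [AddCommGroup A] (mul : A → A → A)
    (gamma : A → A ≃ A) (hgamma : ∀ b a : A, gamma b a = mul a b + a)
    (hbrace : IsBrace mul) :
    IsYB (fun p : A × A => ((gamma (gamma p.1 p.2)).symm p.1, gamma p.1 p.2)) ∧
    (∀ a : A, Function.Bijective (fun b => gamma a b)) ∧
    (∀ b : A, Function.Bijective (fun a : A => (gamma (gamma a b)).symm a)) ∧
    YBUnitary (fun p : A × A => ((gamma (gamma p.1 p.2)).symm p.1, gamma p.1 p.2)) := by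
  obtain ⟨hdist, hassoc, -⟩ := hbrace
  have hadd : ∀ a b c : A, gamma c (a + b) = gamma c a + gamma c b := fun a b c => by
    simp only [hgamma, hdist]
    abel
  have hcomp : ∀ a b c : A, gamma (gamma c b + c) a = gamma c (gamma b a) := fun a b c => by
    simp only [hgamma, hdist, hassoc]
    abel
  let _ := circleGroup gamma hadd hcomp
  have hmul : ∀ a b : A, a * b = gamma b a + b := fun _ _ => rfl
  refine ⟨isYB_gamma hmul hcomp, fun a => (gamma a).bijective,
    gamma_symm_bijective hmul hcomp, ?_⟩
  funext ⟨a, b⟩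
  simp
end

section
/- Let H be a nonempty set, (A,+) an abelian group with a family of multiplications {·_λ : A × A → A}_{λ∈H} each satisfying the right distributive law (a+b)·_λ c = a·_λ c + b·_λ c, and φ : H × A → H a map. Then (A,H,φ;+,{·_λ}_{λ∈H}) is a dynamical brace if and only if, for every λ ∈ H, A is a right quasigroup with respect to the operation a *_λ b := a·_λ b + a + b (i.e., for every a ∈ A the map b ↦ b *_λ a is bijective) and the identity (a *_{φ(λ,c)} b) *_λ c = a *_λ (b *_λ c) holds for all (λ,a,b,c) ∈ H × A × A × A. -/
/-- `(A,H,φ;+,{·_λ})` is a dynamical brace. -/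
def IsDBrace {A H : Type*} [AddCommGroup A] (φ : H × A → H)
    (mul : H → A → A → A) : Prop :=
  (∀ (l : H) (a b c : A), mul l (a + b) c = mul l a c + mul l b c) ∧
  (∀ (l : H) (a b c : A),
    mul l a (mul l b c + b + c) =
      mul l (mul (φ (l, c)) a b) c + mul (φ (l, c)) a b + mul l a c) ∧
  (∀ (l : H) (b : A), Function.Bijective (fun a => mul l a b + a))

theorem stmt9 {A H : Type*} [AddCommGroup A] [Nonempty H] (φ : H × A → H)
    (mul : H → A → A → A)
    (hdist : ∀ (l : H) (a b c : A), mul l (a + b) c = mul l a c + mul l b c) :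
    IsDBrace φ mul ↔
      ((∀ (l : H) (a : A), Function.Bijective (fun b => mul l b a + b + a)) ∧
        ∀ (l : H) (a b c : A),
          mul l (mul (φ (l, c)) a b + a + b) c + (mul (φ (l, c)) a b + a + b) + c =
            mul l a (mul l b c + b + c) + a + (mul l b c + b + c)) := by
  have hbij (l : H) (c : A) : Function.Bijective (fun b => mul l b c + b + c) ↔
      Function.Bijective (fun b => mul l b c + b) :=
    Function.Bijective.of_comp_iff' (Equiv.addRight c).bijective (fun b => mul l b c + b)
  simp only [IsDBrace, hbij, hdist, implies_true, true_and]
  rw [and_comm]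
  refine and_congr_right fun _ => forall₄_congr fun l a b c => ?_
  constructor <;> intro h
  · rw [h]
    abel
  · rw [← sub_eq_zero] at h ⊢
    rw [← neg_eq_zero, ← h]
    abel
end

section
/- Let (A,H,φ;+,{·_λ}_{λ∈H}) be a dynamical brace and set a *_λ b := a·_λ b + a + b. Then for all (λ,a,b) ∈ H × A × A, the multiplications ·_{φ(φ(λ,a),b)} and ·_{φ(λ, b *_λ a)} coincide as maps A × A → A; that is, x ·_{φ(φ(λ,a),b)} y = x ·_{φ(λ, b *_λ a)} y for all x,y ∈ A. -/
/-- The maps `γ_λ(b) : a ↦ a ·_λ b + a` satisfy `γ_λ(b *_λ c) = γ_λ(c) ∘ γ_{φ(λ,c)}(b)`. -/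
theorem IsDBrace.gamma_star {A H : Type*} [AddCommGroup A] {φ : H × A → H}
    {mul : H → A → A → A} (h : IsDBrace φ mul) (l : H) (a b c : A) :
    mul l a (mul l b c + b + c) + a =
      mul l (mul (φ (l, c)) a b + a) c + (mul (φ (l, c)) a b + a) := by
  rw [h.2.1, h.1]
  abel

/-- Dynamical associativity of the operations `a *_λ b = a ·_λ b + a + b`. -/
theorem IsDBrace.star_assoc {A H : Type*} [AddCommGroup A] {φ : H × A → H}
    {mul : H → A → A → A} (h : IsDBrace φ mul) (l : H) (a b c : A) :
    mul l a (mul l b c + b + c) + a + (mul l b c + b + c) =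
      mul l (mul (φ (l, c)) a b + a + b) c + (mul (φ (l, c)) a b + a + b) + c := by
  rw [h.gamma_star, h.1 l _ b]
  abel

theorem stmt10 {A H : Type*} [AddCommGroup A] [Nonempty H] (φ : H × A → H)
    (mul : H → A → A → A) (h : IsDBrace φ mul) :
    ∀ (l : H) (a b x y : A),
      mul (φ (φ (l, a), b)) x y = mul (φ (l, mul l b a + b + a)) x y := by
  intro l a b x y
  apply add_right_cancel (b := x)
  apply (h.2.2 l (mul l b a + b + a)).injective
  change mul l _ _ + _ = mul l _ _ + _
  rw [← h.gamma_star l x y, h.star_assoc, h.gamma_star l x, h.gamma_star (φ (l, a)) x,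
    h.gamma_star l _ b a]
end

section
/- Let (A,H,φ;+,{·_λ}_{λ∈H}) be a dynamical brace and for (λ,a) ∈ H × A define L^λ_a := γ_λ(a) : A → A, c ↦ c·_λ a + c. Then each L^λ_a is an automorphism of the abelian group (A,+), and for all (λ,a,b) ∈ H × A × A: L^λ_a ∘ L^{φ(λ,a)}_b = L^λ_{L^λ_a(b)+a}. -/
theorem stmt12 {A H : Type*} [AddCommGroup A] [Nonempty H] (φ : H × A → H)
    (mul : H → A → A → A) (h : IsDBrace φ mul) :
    (∀ (l : H) (a : A),
      Function.Bijective (fun c => mul l c a + c) ∧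
      ∀ x y : A, mul l (x + y) a + (x + y) = (mul l x a + x) + (mul l y a + y)) ∧
    (∀ (l : H) (a b : A),
      (fun c => mul l c a + c) ∘ (fun c => mul (φ (l, a)) c b + c) =
        fun c => mul l c (mul l b a + b + a) + c) := by
  obtain ⟨hadd, hmul, hbij⟩ := h
  refine ⟨fun l a => ⟨hbij l a, fun x y => ?_⟩, fun l a b => funext fun c => ?_⟩
  · rw [hadd]
    abel
  · simp only [Function.comp_apply]
    rw [hmul, hadd]
    abel
end

section
/- Let (A,+) be an abelian group, H a nonempty set, φ : H × A → H a map, and {L^λ_a : A → A}_{(λ,a)∈H×A} a family of automorphisms of the abelian group (A,+) satisfying L^λ_a ∘ L^{φ(λ,a)}_b = L^λ_{L^λ_a(b)+a} for all (λ,a,b) ∈ H × A × A. Define multiplications on A by a ·_λ b := L^λ_b(a) − a. Then (A,H,φ;+,{·_λ}_{λ∈H}) is a dynamical brace. -/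
theorem stmt13 {A H : Type*} [AddCommGroup A] [Nonempty H] (φ : H × A → H)
    (L : H → A → A ≃+ A)
    (hL : ∀ (l : H) (a b : A),
      ⇑(L l a) ∘ ⇑(L (φ (l, a)) b) = ⇑(L l ((L l a) b + a))) :
    IsDBrace φ (fun l a b => (L l b) a - a) := by
  refine ⟨fun l a b c => ?_, fun l a b c => ?_, fun l b => ?_⟩
  · simp only [map_add]
    abel
  · have h := congrFun (hL l c b) a
    simp only [Function.comp_apply] at h
    simp only [sub_add_cancel, ← h, map_sub]
    abel
  · simpa only [sub_add_cancel] using (L l b).bijective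
end

section
/- Let (A,H,φ;+,{·_λ}_{λ∈H}) be a dynamical brace with γ_λ(b) : a ↦ a·_λ b + a. Then the family of maps R(λ) : A × A → A × A defined by R(λ)(a,b) := (γ_λ(γ_λ(a)(b))⁻¹(a), γ_λ(a)(b)) is a right nondegenerate dynamical Yang-Baxter map associated with A, H, φ satisfying the unitary condition. -/
theorem gamma_comp {A H : Type*} [AddCommGroup A] {φ : H × A → H} {mul : H → A → A → A}
    {gamma : H → A → A ≃ A} (hgamma : ∀ (l : H) (b a : A), gamma l b a = mul l a b + a)
    (h : IsDBrace φ mul) (l : H) (b c x : A) :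
    gamma l c (gamma (φ (l, c)) b x) = gamma l (gamma l c b + c) x := by
  simp only [hgamma, h.1, h.2.1]
  abel

/-- The two components of `R(l)(a, b)` have the same product as `a` and `b`. -/
theorem gamma_comp_exchange {A H : Type*} [AddCommGroup A] {φ : H × A → H}
    {mul : H → A → A → A} {gamma : H → A → A ≃ A}
    (hgamma : ∀ (l : H) (b a : A), gamma l b a = mul l a b + a)
    (h : IsDBrace φ mul) (l : H) (a b x : A) :
    gamma l (gamma l a b) (gamma (φ (l, gamma l a b)) ((gamma l (gamma l a b)).symm a) x) =
      gamma l a (gamma (φ (l, a)) b x) := by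
  rw [gamma_comp hgamma h, gamma_comp hgamma h, Equiv.apply_symm_apply, add_comm]

theorem stmt14 {A H : Type*} [AddCommGroup A] [Nonempty H] (φ : H × A → H)
    (mul : H → A → A → A) (gamma : H → A → A ≃ A)
    (hgamma : ∀ (l : H) (b a : A), gamma l b a = mul l a b + a)
    (h : IsDBrace φ mul) :
    IsDYB φ (fun l p => ((gamma l (gamma l p.1 p.2)).symm p.1, gamma l p.1 p.2)) ∧
    RightNondeg (fun (l : H) (p : A × A) => ((gamma l (gamma l p.1 p.2)).symm p.1, gamma l p.1 p.2)) ∧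
    DYBUnitary (fun (l : H) (p : A × A) => ((gamma l (gamma l p.1 p.2)).symm p.1, gamma l p.1 p.2)) := by
  have exch := gamma_comp_exchange hgamma h
  refine ⟨fun l => funext fun ⟨a, b, c⟩ => ?_, fun l a => (gamma l a).bijective,
    fun l => funext fun ⟨a, b⟩ => by simp⟩
  simp only [R12, R13, R23, Function.comp_apply]
  set b₁ := gamma l a b
  set a₁ := (gamma l b₁).symm a
  set c₁ := gamma (φ (l, b₁)) a₁ c
  set c₁' := gamma (φ (l, a)) b c
  have hc : gamma l b₁ c₁ = gamma l a c₁' := exch l a b c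
  have hb : (gamma l (gamma l b₁ c₁)).symm b₁ =
      gamma (φ (l, gamma l a c₁')) ((gamma l (gamma l a c₁')).symm a)
        ((gamma (φ (l, a)) c₁').symm b) := by
    rw [Equiv.symm_apply_eq, hc, exch, Equiv.apply_symm_apply]
  have ha : (gamma (φ (l, b₁)) c₁).symm a₁ =
      (gamma (φ (l, gamma l b₁ c₁)) ((gamma l (gamma l b₁ c₁)).symm b₁)).symm
        ((gamma l (gamma l b₁ c₁)).symm a) := by
    rw [Equiv.eq_symm_apply, Equiv.eq_symm_apply, exch, Equiv.apply_symm_apply,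
      Equiv.apply_symm_apply]
  rw [← hb, ← hc, ha]
end

section
/- Let (A,+) be an abelian group, H a nonempty set, φ : H × A → H a map, and {L^λ_a : A → A}_{(λ,a)∈H×A} a family of automorphisms of the abelian group (A,+) satisfying L^λ_a ∘ L^{φ(λ,a)}_b = L^λ_{L^λ_a(b)+a} for all (λ,a,b) ∈ H × A × A. Then L^{φ(φ(λ,a),b)}_c = L^{φ(λ, L^λ_a(b)+a)}_c for all (λ,a,b,c) ∈ H × A × A × A. -/
theorem stmt15 {A H : Type*} [AddCommGroup A] [Nonempty H] (φ : H × A → H)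
    (L : H → A → A ≃+ A)
    (hL : ∀ (l : H) (a b : A),
      ⇑(L l a) ∘ ⇑(L (φ (l, a)) b) = ⇑(L l ((L l a) b + a))) :
    ∀ (l : H) (a b c : A), L (φ (φ (l, a), b)) c = L (φ (l, (L l a) b + a)) c := by
  intro l a b c
  have hL' (l : H) (a b x : A) : L l a (L (φ (l, a)) b x) = L l (L l a b + a) x :=
    congrFun (hL l a b) x
  ext x
  apply (L l (L l a b + a)).injective
  rw [hL' l (L l a b + a), ← hL' l a b, hL' (φ (l, a)) b c, hL' l a, map_add, hL' l a b c,
    add_assoc]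
end

section
/- Let (A,H,φ;+,{·_λ}_{λ∈H}) be a dynamical brace, set a *_λ b := a·_λ b + a + b and γ_λ(a) : c ↦ c·_λ a + c, and for λ ∈ H define the subset S_λ := {(a, γ_λ(a)) : a ∈ A} of the semidirect product A ⋊ Aut(A) (with multiplication (a,f)(b,g) = (a + f(b), f ∘ g)). Then: (a) for every a ∈ A there is a unique f ∈ Aut(A) with (a,f) ∈ S_λ, namely f = γ_λ(a); and (b) for every (λ,a) ∈ H × A, (a, γ_λ(a))⁻¹ S_λ := {(a, γ_λ(a))⁻¹ (b,g) : (b,g) ∈ S_λ} = S_{φ(λ,a)}. -/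
/-- Multiplication of the semidirect product `A ⋊ Aut(A)`:
`(a, f)(b, g) = (a + f(b), f ∘ g)`. -/
def sdMul {A : Type*} [AddCommGroup A] (p q : A × (A ≃+ A)) : A × (A ≃+ A) :=
  (p.1 + p.2 q.1, q.2.trans p.2)

/-- Inversion in the semidirect product `A ⋊ Aut(A)`: `(a, f)⁻¹ = (−f⁻¹(a), f⁻¹)`. -/
def sdInv {A : Type*} [AddCommGroup A] (p : A × (A ≃+ A)) : A × (A ≃+ A) :=
  (-(p.2.symm p.1), p.2.symm)

theorem IsDBrace.gamma_gamma_add {A H : Type*} [AddCommGroup A] {φ : H × A → H}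
    {mul : H → A → A → A} {gamma : H → A → A ≃+ A}
    (hgamma : ∀ (l : H) (a c : A), gamma l a c = mul l c a + c)
    (h : IsDBrace φ mul) (l : H) (a b : A) :
    gamma l (gamma l a b + a) = (gamma (φ (l, a)) b).trans (gamma l a) := by
  ext x
  simp only [AddEquiv.trans_apply, hgamma, h.1, h.2.1]
  abel

theorem IsDBrace.sdMul_sdInv {A H : Type*} [AddCommGroup A] {φ : H × A → H}
    {mul : H → A → A → A} {gamma : H → A → A ≃+ A}
    (hgamma : ∀ (l : H) (a c : A), gamma l a c = mul l c a + c)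
    (h : IsDBrace φ mul) (l : H) (a b : A) :
    sdMul (sdInv (a, gamma l a)) (gamma l a b + a, gamma l (gamma l a b + a)) =
      (b, gamma (φ (l, a)) b) := by
  rw [h.gamma_gamma_add hgamma]
  ext x
  · simp [sdMul, sdInv]
  · simp [sdMul, sdInv]

theorem stmt17 {A H : Type*} [AddCommGroup A] [Nonempty H] (φ : H × A → H)
    (mul : H → A → A → A) (gamma : H → A → A ≃+ A)
    (hgamma : ∀ (l : H) (a c : A), gamma l a c = mul l c a + c)
    (h : IsDBrace φ mul) :
    (∀ (l : H) (a : A) (F : A ≃+ A),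
        (a, F) ∈ {p : A × (A ≃+ A) | ∃ b : A, p = (b, gamma l b)} ↔ F = gamma l a) ∧
    (∀ (l : H) (a : A),
        (fun q => sdMul (sdInv (a, gamma l a)) q) ''
            {p : A × (A ≃+ A) | ∃ b : A, p = (b, gamma l b)} =
          {p : A × (A ≃+ A) | ∃ b : A, p = (b, gamma (φ (l, a)) b)}) := by
  refine ⟨fun l a F => ⟨?_, fun hF => ⟨a, by rw [hF]⟩⟩, fun l a => Set.ext fun p => ⟨?_, ?_⟩⟩
  · rintro ⟨b, hb⟩
    obtain ⟨rfl, rfl⟩ := Prod.mk.inj hb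
    rfl
  · rintro ⟨_, ⟨b, rfl⟩, rfl⟩
    obtain ⟨c, hc⟩ := (gamma l a).surjective (b - a)
    obtain rfl : gamma l a c + a = b := by rw [hc, sub_add_cancel]
    exact ⟨c, h.sdMul_sdInv hgamma l a c⟩
  · rintro ⟨b, rfl⟩
    exact ⟨_, ⟨gamma l a b + a, rfl⟩, h.sdMul_sdInv hgamma l a b⟩
end

section
/- Let (A,+) be an abelian group, H a nonempty set, and {S_λ}_{λ∈H} a family of subsets of the semidirect product A ⋊ Aut(A) (with multiplication (a,f)(b,g) = (a + f(b), f ∘ g)) satisfying: (a) for every λ ∈ H and every a ∈ A there is a unique f ∈ Aut(A), denoted f_λ(a), with (a,f) ∈ S_λ; and (b) for every λ ∈ H and every (a,f) ∈ S_λ there is a unique μ ∈ H with (a,f)⁻¹ S_λ := {(a,f)⁻¹(b,g) : (b,g) ∈ S_λ} = S_μ. Define φ : H × A → H by letting φ(λ,a) be the unique μ from condition (b) for (a, f_λ(a)) ∈ S_λ, and define multiplications on A by a ·_λ b := f_λ(b)(a) − a. Then (A,H,φ;+,{·_λ}_{λ∈H}) is a dynamical brace. -/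
theorem stmt18 {A H : Type*} [AddCommGroup A] [Nonempty H]
    (S : H → Set (A × (A ≃+ A))) (fF : H → A → A ≃+ A) (φ : H × A → H)
    (hex : ∀ (l : H) (a : A), (a, fF l a) ∈ S l)
    (huniq : ∀ (l : H) (a : A) (F : A ≃+ A), (a, F) ∈ S l → F = fF l a)
    (hb : ∀ (l : H), ∀ p ∈ S l, ∃! μ : H, (fun q => sdMul (sdInv p) q) '' S l = S μ)
    (hφ : ∀ (l : H) (a : A),
        (fun q => sdMul (sdInv (a, fF l a)) q) '' S l = S (φ (l, a))) :
    IsDBrace φ (fun l a b => fF l b a - a) := by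
  refine ⟨fun l a b c => ?_, fun l a b c => ?_, fun l b => ?_⟩
  · simp only [map_add]
    abel
  · have hmem : sdMul (sdInv (c, fF l c)) (c + fF l c b, fF l (c + fF l c b)) ∈ S (φ (l, c)) := by
      rw [← hφ l c]
      exact ⟨_, hex l _, rfl⟩
    have hsd : sdMul (sdInv (c, fF l c)) (c + fF l c b, fF l (c + fF l c b)) =
        (b, (fF l (c + fF l c b)).trans (fF l c).symm) := by
      simp [sdMul, sdInv]
    rw [hsd] at hmem
    have key : fF l c (fF (φ (l, c)) b a) = fF l (c + fF l c b) a := by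
      rw [← huniq _ _ _ hmem]
      simp
    have harg : fF l c b - b + b + c = c + fF l c b := by abel
    simp only [harg, map_sub, key]
    abel
  · simpa only [sub_add_cancel] using (fF l b).bijective
end
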